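/- Let G be a finite simple graph whose vertex set can be partitioned into a global offensive alliance X_1 and a global strong offensive alliance X_2, and let H be a finite simple graph whose vertex set can be partitioned into a global offensive alliance Y_1 and a global strong offensive alliance Y_2. Then γo(G □ H) ≤ |X_1|·|Y_1| + |X_2|·|Y_2|, where γo denotes the global offensive alliance number. -/

import Mathlib

open SimpleGraph

/-- `S` is a global offensive alliance in `G`: every vertex outside `S` has at least
one more neighbor inside `S` than outside `S`. -/
def IsGlobalOffensiveAlliance {V : Type*} (G : SimpleGraph V) (S : Set V) : Prop :=
  ∀ v ∉ S, (G.neighborSet v ∩ S).ncard ≥ (G.neighborSet v \ S).ncard + 1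

/-- `S` is a global strong offensive alliance in `G`. -/
def IsGlobalStrongOffensiveAlliance {V : Type*} (G : SimpleGraph V) (S : Set V) : Prop :=
  ∀ v ∉ S, (G.neighborSet v ∩ S).ncard ≥ (G.neighborSet v \ S).ncard

/-- The global offensive alliance number `γₒ(G)`. -/
noncomputable def globalOffensiveAllianceNumber {V : Type*} (G : SimpleGraph V) : ℕ :=
  sInf {n | ∃ S : Set V, IsGlobalOffensiveAlliance G S ∧ S.ncard = n}

/-- `S` is a dominating set in `G`. -/
def IsDominatingSet {V : Type*} (G : SimpleGraph V) (S : Set V) : Prop :=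
  ∀ v ∉ S, ∃ u ∈ S, G.Adj u v

/-- The domination number `γ(G)`. -/
noncomputable def dominationNumber {V : Type*} (G : SimpleGraph V) : ℕ :=
  sInf {n | ∃ S : Set V, IsDominatingSet G S ∧ S.ncard = n}

/-- `S` is an efficient dominating set: a dominating set whose closed neighborhoods
are pairwise disjoint. -/
def IsEfficientDominatingSet {V : Type*} (G : SimpleGraph V) (S : Set V) : Prop :=
  IsDominatingSet G S ∧
    S.Pairwise fun u w =>
      Disjoint (insert u (G.neighborSet u)) (insert w (G.neighborSet w))

/-- Neighbors of `(x, y)` in `G □ H` lying in `P` are counted along the two fibers through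
`(x, y)`. -/
theorem ncard_boxProd_neighborSet_inter {V W : Type*} [Finite V] [Finite W]
    (G : SimpleGraph V) (H : SimpleGraph W) (x : V) (y : W) (P : Set (V × W)) :
    ((G.boxProd H).neighborSet (x, y) ∩ P).ncard =
      (G.neighborSet x ∩ {a | (a, y) ∈ P}).ncard +
        (H.neighborSet y ∩ {b | (x, b) ∈ P}).ncard := by
  have heq : (G.boxProd H).neighborSet (x, y) ∩ P =
      (fun a => (a, y)) '' (G.neighborSet x ∩ {a | (a, y) ∈ P}) ∪
        (fun b => (x, b)) '' (H.neighborSet y ∩ {b | (x, b) ∈ P}) := by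
    ext ⟨a, b⟩
    simp only [Set.mem_inter_iff, mem_neighborSet, boxProd_adj, Set.mem_union, Set.mem_image,
      Set.mem_ofPred_eq, Prod.mk.injEq]
    constructor
    · rintro ⟨⟨h, rfl⟩ | ⟨h, rfl⟩, hP⟩
      · exact Or.inl ⟨a, ⟨h, hP⟩, rfl, rfl⟩
      · exact Or.inr ⟨b, ⟨h, hP⟩, rfl, rfl⟩
    · rintro (⟨a, ⟨h, hP⟩, rfl, rfl⟩ | ⟨b, ⟨h, hP⟩, rfl, rfl⟩)
      · exact ⟨Or.inl ⟨h, rfl⟩, hP⟩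
      · exact ⟨Or.inr ⟨h, rfl⟩, hP⟩
  have hdisj : Disjoint ((fun a => (a, y)) '' (G.neighborSet x ∩ {a | (a, y) ∈ P}))
      ((fun b => (x, b)) '' (H.neighborSet y ∩ {b | (x, b) ∈ P})) := by
    rw [Set.disjoint_left]
    rintro _ ⟨a, ⟨ha, -⟩, rfl⟩ ⟨b, -, hb⟩
    obtain ⟨rfl, -⟩ := Prod.mk.inj hb
    exact G.irrefl ha
  rw [heq, Set.ncard_union_eq hdisj (Set.toFinite _) (Set.toFinite _),
    Set.ncard_image_of_injective _ (Prod.mk_left_injective y),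
    Set.ncard_image_of_injective _ (Prod.mk_right_injective x)]

theorem IsGlobalOffensiveAlliance.boxProd {V W : Type*} [Finite V] [Finite W]
    {G : SimpleGraph V} {H : SimpleGraph W} {X : Set V} {Y : Set W}
    (hX : IsGlobalOffensiveAlliance G X) (hX' : IsGlobalStrongOffensiveAlliance G Xᶜ)
    (hY : IsGlobalOffensiveAlliance H Y) (hY' : IsGlobalStrongOffensiveAlliance H Yᶜ) :
    IsGlobalOffensiveAlliance (G.boxProd H) (X ×ˢ Y ∪ Xᶜ ×ˢ Yᶜ) := by
  rintro ⟨x, y⟩ hxy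
  simp only [Set.mem_union, Set.mem_prod, Set.mem_compl_iff] at hxy
  rw [Set.sdiff_eq, ncard_boxProd_neighborSet_inter, ncard_boxProd_neighborSet_inter]
  by_cases hx : x ∈ X
  · have hy : y ∉ Y := fun hy => hxy (Or.inl ⟨hx, hy⟩)
    have h₁ := hX' x (by simpa using hx)
    have h₂ := hY y hy
    have e₁ : {a | (a, y) ∈ X ×ˢ Y ∪ Xᶜ ×ˢ Yᶜ} = Xᶜ := by ext; simp [hy]
    have e₂ : {b | (x, b) ∈ X ×ˢ Y ∪ Xᶜ ×ˢ Yᶜ} = Y := by ext; simp [hx]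
    have e₃ : {a | (a, y) ∈ (X ×ˢ Y ∪ Xᶜ ×ˢ Yᶜ)ᶜ} = Xᶜᶜ := congrArg compl e₁
    have e₄ : {b | (x, b) ∈ (X ×ˢ Y ∪ Xᶜ ×ˢ Yᶜ)ᶜ} = Yᶜ := congrArg compl e₂
    rw [e₁, e₂, e₃, e₄]
    rw [Set.sdiff_eq] at h₁ h₂
    omega
  · have hy : y ∈ Y := by_contra fun hy => hxy (Or.inr ⟨hx, hy⟩)
    have h₁ := hX x hx
    have h₂ := hY' y (by simpa using hy)
    have e₁ : {a | (a, y) ∈ X ×ˢ Y ∪ Xᶜ ×ˢ Yᶜ} = X := by ext; simp [hy]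
    have e₂ : {b | (x, b) ∈ X ×ˢ Y ∪ Xᶜ ×ˢ Yᶜ} = Yᶜ := by ext; simp [hx]
    have e₃ : {a | (a, y) ∈ (X ×ˢ Y ∪ Xᶜ ×ˢ Yᶜ)ᶜ} = Xᶜ := congrArg compl e₁
    have e₄ : {b | (x, b) ∈ (X ×ˢ Y ∪ Xᶜ ×ˢ Yᶜ)ᶜ} = Yᶜᶜ := congrArg compl e₂
    rw [e₁, e₂, e₃, e₄]
    rw [Set.sdiff_eq] at h₁ h₂
    omega

theorem stmt13 {V W : Type*} [Fintype V] [Fintype W]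
    (G : SimpleGraph V) (H : SimpleGraph W)
    (X₁ X₂ : Set V) (hXdisj : Disjoint X₁ X₂) (hXunion : X₁ ∪ X₂ = Set.univ)
    (hX₁ : IsGlobalOffensiveAlliance G X₁) (hX₂ : IsGlobalStrongOffensiveAlliance G X₂)
    (Y₁ Y₂ : Set W) (hYdisj : Disjoint Y₁ Y₂) (hYunion : Y₁ ∪ Y₂ = Set.univ)
    (hY₁ : IsGlobalOffensiveAlliance H Y₁) (hY₂ : IsGlobalStrongOffensiveAlliance H Y₂) :
    globalOffensiveAllianceNumber (G.boxProd H) ≤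
      X₁.ncard * Y₁.ncard + X₂.ncard * Y₂.ncard := by
  obtain rfl : X₁ᶜ = X₂ :=
    (IsCompl.of_eq (Set.disjoint_iff_inter_eq_empty.mp hXdisj) hXunion).compl_eq
  obtain rfl : Y₁ᶜ = Y₂ :=
    (IsCompl.of_eq (Set.disjoint_iff_inter_eq_empty.mp hYdisj) hYunion).compl_eq
  refine le_trans (Nat.sInf_le ⟨_, hX₁.boxProd hX₂ hY₁ hY₂, rfl⟩) ?_
  refine (Set.ncard_union_le _ _).trans ?_
  rw [Set.ncard_prod, Set.ncard_prod]
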